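/- arXiv:2302.13426 — 2 statements merged into one kernel-verified Lean document; each statement's English description precedes it below -/
import Mathlib

section
/- Fix an integer I ≥ 2. There exists a real number α* > 0 such that the matrix α*·Q is an equilibrium of the canonical game: for every signal index i ∈ {1,…,I}, the i-th column α*·Q·e_i is a global maximizer over ℝ^I of the map d ↦ J(d; α*·Q, i). -/
open MeasureTheory ProbabilityTheory Matrix

noncomputable section

/-- The standard Gaussian measure `γ_I` on `ℝ^I` (mean 0, identity covariance). -/
def stdGaussian (I : ℕ) : Measure (Fin I → ℝ) :=
  Measure.pi fun _ => gaussianReal 0 1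

/-- The matrix `Q = Id − (1/I)·𝟙𝟙ᵀ`. -/
def Qmat (I : ℕ) : Matrix (Fin I) (Fin I) ℝ :=
  1 - (I : ℝ)⁻¹ • Matrix.of fun _ _ => (1 : ℝ)

/-- The posterior map `p(·; D̂)`:
`p_j(ω; D̂) = exp(⟨d̂⁽ʲ⁾, ω⟩ − ½‖d̂⁽ʲ⁾‖²) / Σ_k exp(⟨d̂⁽ᵏ⁾, ω⟩ − ½‖d̂⁽ᵏ⁾‖²)`,
where `d̂⁽ʲ⁾ = D̂ e_j` is the `j`-th column of `D̂`. -/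
def postMap (I : ℕ) (D : Matrix (Fin I) (Fin I) ℝ) (ω : Fin I → ℝ) : Fin I → ℝ :=
  fun j => Real.exp ((∑ k, D k j * ω k) - (∑ k, (D k j) ^ 2) / 2) /
    ∑ l, Real.exp ((∑ k, D k l * ω k) - (∑ k, (D k l) ^ 2) / 2)

/-- `π̄(d; D̂) = ∫ p(d + x; D̂) dγ_I(x)`. -/
def postBar (I : ℕ) (D : Matrix (Fin I) (Fin I) ℝ) (d : Fin I → ℝ) : Fin I → ℝ :=
  fun j => ∫ x, postMap I D (d + x) j ∂(stdGaussian I)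

/-- The insider's canonical objective `J(d; D̂, i) = ⟨e_i, d⟩ − ⟨π̄(d; D̂), d⟩`. -/
def Jobj (I : ℕ) (D : Matrix (Fin I) (Fin I) ℝ) (i : Fin I) (d : Fin I → ℝ) : ℝ :=
  d i - ∑ j, postBar I D d j * d j

/-- `D*` is an equilibrium of the canonical game if for every signal `i` the
`i`-th column `D* e_i` globally maximizes `d ↦ J(d; D*, i)` over `ℝ^I`. -/
def IsEquilibrium (I : ℕ) (D : Matrix (Fin I) (Fin I) ℝ) : Prop :=
  ∀ i : Fin I, ∀ d : Fin I → ℝ, Jobj I D i d ≤ Jobj I D i (fun k => D k i)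

/-- Exponentially tilted moments of a Gaussian weighted by `exp (-exp (a x))`. -/
def tiltMoment (a : ℝ) (n : ℕ) (θ : ℝ) : ℝ :=
  ∫ x, x ^ n * Real.exp (θ * x) * Real.exp (-Real.exp (a * x)) ∂(gaussianReal 0 1)

/-- The Gaussian average of `exp (m z - exp z)` for `z` normal with mean `y`, deviation `a`. -/
def gumbelMoment (a : ℝ) (m : ℕ) (y : ℝ) : ℝ :=
  ∫ x, Real.exp (m * (y + a * x) - Real.exp (y + a * x)) ∂(gaussianReal 0 1)

lemma integrable_pow_mul_exp_gaussian (n : ℕ) (θ : ℝ) :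
    Integrable (fun x : ℝ => x ^ n * Real.exp (θ * x)) (gaussianReal 0 1) := by
  have := integrable_pow_mul_exp_of_mem_interior_integrableExpSet (X := id)
    (μ := gaussianReal 0 1) (v := θ) (by simp [integrableExpSet_id_gaussianReal]) n
  simpa using this

lemma integrable_tiltMoment (a : ℝ) (n : ℕ) (θ : ℝ) :
    Integrable (fun x : ℝ => x ^ n * Real.exp (θ * x) * Real.exp (-Real.exp (a * x)))
      (gaussianReal 0 1) := by
  refine (integrable_pow_mul_exp_gaussian n θ).mul_bdd (c := 1) (by fun_prop) ?_
  filter_upwards with x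
  simpa using (Real.exp_pos _).le

lemma hasDerivAt_tiltMoment (a : ℝ) (n : ℕ) (θ : ℝ) :
    HasDerivAt (tiltMoment a n) (tiltMoment a (n + 1) θ) θ := by
  set ν := (gaussianReal 0 1).withDensity fun x => ENNReal.ofReal (Real.exp (-Real.exp (a * x)))
    with hν
  have hm : Measurable fun x : ℝ => ENNReal.ofReal (Real.exp (-Real.exp (a * x))) := by fun_prop
  have key : ∀ (k : ℕ) (t : ℝ), ∫ x, x ^ k * Real.exp (t * x) ∂ν = tiltMoment a k t := by
    intro k t
    rw [hν, integral_withDensity_eq_integral_toReal_smul hm (by simp)]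
    refine integral_congr_ae (Filter.Eventually.of_forall fun x => ?_)
    simp only [smul_eq_mul, ENNReal.toReal_ofReal (Real.exp_pos _).le]
    ring
  have hle : ν ≤ gaussianReal 0 1 := by
    conv_rhs => rw [← withDensity_one (μ := gaussianReal 0 1)]
    refine withDensity_mono (Filter.Eventually.of_forall fun x => ?_)
    simpa using (Real.exp_pos _).le
  have hs : integrableExpSet id ν = Set.univ := by
    refine Set.eq_univ_of_forall fun t => ?_
    have h := integrable_exp_mul_gaussianReal (μ := 0) (v := 1) t
    exact h.mono_measure hle
  have h := hasDerivAt_integral_pow_mul_exp_real (X := id) (μ := ν) (t := θ) (by simp [hs]) n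
  simp only [id] at h
  rw [key] at h
  exact h.congr_of_eventuallyEq (Filter.Eventually.of_forall fun t => (key n t).symm)

lemma tiltMoment_zero_pos (a θ : ℝ) : 0 < tiltMoment a 0 θ := by
  unfold tiltMoment
  have : ∀ x : ℝ, 0 < x ^ 0 * Real.exp (θ * x) * Real.exp (-Real.exp (a * x)) := fun x => by
    positivity
  rw [integral_pos_iff_support_of_nonneg (fun x => (this x).le) (integrable_tiltMoment a 0 θ)]
  rw [Function.support_eq_univ fun x => (this x).ne']
  simp

/-- Affine-minus-`sinh` functions change sign at most once on the half line. -/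
lemma exists_sign_change {a : ℝ} (ha : 0 < a) (b : ℝ) {c : ℝ} (hc : 0 < c) :
    ∃ s₀ : ℝ, 0 ≤ s₀ ∧ (∀ s, 0 ≤ s → s ≤ s₀ → 0 ≤ b * s - c * Real.sinh (a * s)) ∧
      ∀ s, s₀ ≤ s → b * s - c * Real.sinh (a * s) ≤ 0 := by
  set D : ℝ → ℝ := fun s => b * s - c * Real.sinh (a * s) with hD
  have hcont : Continuous D := by fun_prop
  set T : Set ℝ := {s | 0 ≤ s ∧ 0 ≤ D s} with hT
  have h0 : (0 : ℝ) ∈ T := by simp [hT, hD]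
  have hbd : BddAbove T := by
    refine ⟨|b| * 4 / (c * a ^ 2), fun s hs => ?_⟩
    obtain ⟨hs0, hs1⟩ := hs
    have hD0 : c * Real.sinh (a * s) ≤ b * s := by simpa [hD] using hs1
    rw [Real.sinh_eq] at hD0
    have h1 := Real.quadratic_le_exp_of_nonneg (mul_nonneg ha.le hs0)
    have h2 : Real.exp (-(a * s)) ≤ 1 := Real.exp_le_one_iff.2 (by nlinarith)
    have h3 : c * ((a * s) ^ 2 / 4) ≤ |b| * s := by
      have : (a * s) ^ 2 / 4 ≤ (Real.exp (a * s) - Real.exp (-(a * s))) / 2 := by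
        nlinarith [mul_nonneg ha.le hs0]
      calc _ ≤ _ := mul_le_mul_of_nonneg_left this hc.le
        _ ≤ b * s := hD0
        _ ≤ _ := mul_le_mul_of_nonneg_right (le_abs_self b) hs0
    rw [le_div_iff₀ (by positivity)]
    rcases hs0.eq_or_lt with rfl | hpos
    · simp
    · have : s * (s * (c * a ^ 2)) ≤ s * (|b| * 4) := by nlinarith
      exact le_of_mul_le_mul_left this hpos
  have hclosed : IsClosed T :=
    (isClosed_le continuous_const continuous_id).inter (isClosed_le continuous_const hcont)
  have hmem : sSup T ∈ T := hclosed.csSup_mem ⟨0, h0⟩ hbd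
  have hconc : ConcaveOn ℝ (Set.Ici 0) D := by
    have hd : ∀ s, HasDerivAt D (b - c * (Real.cosh (a * s) * a)) s := fun s => by
      have h1 : HasDerivAt (fun s : ℝ => a * s) a s := by
        simpa using (hasDerivAt_id s).const_mul a
      have h2 := (h1.sinh).const_mul c
      have h3 : HasDerivAt (fun s : ℝ => b * s) b s := by
        simpa using (hasDerivAt_id s).const_mul b
      exact h3.sub h2
    refine AntitoneOn.concaveOn_of_deriv (convex_Ici 0) hcont.continuousOn
      (fun s _ => (hd s).differentiableAt.differentiableWithinAt) ?_
    intro s hs t ht hst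
    rw [(hd s).deriv, (hd t).deriv]
    simp only [interior_Ici, Set.mem_Ioi] at hs ht
    have : Real.cosh (a * s) ≤ Real.cosh (a * t) := by
      rw [Real.cosh_le_cosh, abs_of_pos (by positivity), abs_of_pos (by positivity)]
      gcongr
    have := mul_le_mul_of_nonneg_left (mul_le_mul_of_nonneg_right this ha.le) hc.le
    linarith
  refine ⟨sSup T, hmem.1, fun s hs hs' => ?_, fun s hs => ?_⟩
  · have hseg : s ∈ segment ℝ 0 (sSup T) := by
      rw [segment_eq_Icc hmem.1]; exact ⟨hs, hs'⟩
    have := hconc.ge_on_segment (x := 0) (y := sSup T) (by simp) hmem.1 hseg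
    have h00 : D 0 = 0 := by simp [hD]
    rw [h00, min_eq_left hmem.2] at this
    exact this
  · rcases hs.eq_or_lt with h | h
    · rw [← h]
      by_contra hcon
      push Not at hcon
      have hev : ∀ᶠ x in nhds (sSup T), 0 < D x := hcont.continuousAt.eventually (lt_mem_nhds hcon)
      obtain ⟨ε, hε, hball⟩ := Metric.eventually_nhds_iff.1 hev
      have h1 : sSup T + ε / 2 ∈ T := by
        refine ⟨by linarith [hmem.1], (hball ?_).le⟩
        rw [Real.dist_eq, add_sub_cancel_left, abs_of_pos (by positivity)]
        linarith
      linarith [le_csSup hbd h1]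
    · by_contra hcon
      push Not at hcon
      exact absurd (le_csSup hbd ⟨hmem.1.trans hs, hcon.le⟩) (not_le.2 h)

/-- The exponentially tilted law is negatively skewed. -/
lemma third_central_moment_nonpos {a : ℝ} (ha : 0 < a) (θ m : ℝ)
    (hm : ∫ x, (x - m) * Real.exp (θ * x) * Real.exp (-Real.exp (a * x)) ∂(gaussianReal 0 1) = 0)
    (h1 : Integrable (fun x => (x - m) * Real.exp (θ * x) * Real.exp (-Real.exp (a * x)))
      (gaussianReal 0 1))
    (h3 : Integrable (fun x => (x - m) ^ 3 * Real.exp (θ * x) * Real.exp (-Real.exp (a * x)))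
      (gaussianReal 0 1)) :
    ∫ x, (x - m) ^ 3 * Real.exp (θ * x) * Real.exp (-Real.exp (a * x)) ∂(gaussianReal 0 1) ≤ 0 := by
  obtain ⟨s₀, hs₀, hpos, hneg⟩ := exists_sign_change ha (θ - m)
    (Real.exp_pos (a * m))
  set F : ℝ → ℝ := fun x => gaussianPDFReal 0 1 x *
    (Real.exp (θ * x) * Real.exp (-Real.exp (a * x))) with hF
  have hI : ∫ x, (x - m) ^ 3 * Real.exp (θ * x) * Real.exp (-Real.exp (a * x))
      ∂(gaussianReal 0 1) = ∫ s, s * (s ^ 2 - s₀ ^ 2) * F (s + m) := by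
    have e1 : ∫ x, (x - m) ^ 3 * Real.exp (θ * x) * Real.exp (-Real.exp (a * x))
        ∂(gaussianReal 0 1) = ∫ x, ((x - m) ^ 3 * Real.exp (θ * x) * Real.exp (-Real.exp (a * x))
          - s₀ ^ 2 * ((x - m) * Real.exp (θ * x) * Real.exp (-Real.exp (a * x))))
        ∂(gaussianReal 0 1) := by
      rw [integral_sub h3 (h1.const_mul _), integral_const_mul, hm]; simp
    rw [e1, integral_gaussianReal_eq_integral_smul one_ne_zero,
      ← integral_add_right_eq_self _ m]
    refine integral_congr_ae (Filter.Eventually.of_forall fun x => ?_)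
    simp only [hF, smul_eq_mul]
    ring
  rw [hI]
  by_cases hInt : Integrable (fun s => s * (s ^ 2 - s₀ ^ 2) * F (s + m))
  swap
  · rw [integral_undef hInt]
  have hsym : ∫ s, s * (s ^ 2 - s₀ ^ 2) * F (s + m) =
      ∫ s, (-s) * ((-s) ^ 2 - s₀ ^ 2) * F (-s + m) :=
    (integral_neg_eq_self (fun s => s * (s ^ 2 - s₀ ^ 2) * F (s + m)) volume).symm
  have hInt' : Integrable fun s => (-s) * ((-s) ^ 2 - s₀ ^ 2) * F (-s + m) := hInt.comp_neg
  have hFle : ∀ x y, (θ * x - x ^ 2 / 2 - Real.exp (a * x)) ≤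
      (θ * y - y ^ 2 / 2 - Real.exp (a * y)) → F x ≤ F y := by
    intro x y hxy
    have hrw : ∀ z, F z = (√(2 * Real.pi))⁻¹ *
        Real.exp (θ * z - z ^ 2 / 2 - Real.exp (a * z)) := by
      intro z
      simp only [hF, gaussianPDFReal, NNReal.coe_one, mul_one, sub_zero]
      rw [mul_assoc, ← Real.exp_add, ← Real.exp_add]
      congr 2
      ring
    rw [hrw, hrw]
    gcongr
  have hdiff : ∀ s, (θ * (s + m) - (s + m) ^ 2 / 2 - Real.exp (a * (s + m))) -
      (θ * (-s + m) - (-s + m) ^ 2 / 2 - Real.exp (a * (-s + m))) =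
      2 * ((θ - m) * s - Real.exp (a * m) * Real.sinh (a * s)) := by
    intro s
    rw [Real.sinh_eq, show a * (s + m) = a * m + a * s by ring,
      show a * (-s + m) = a * m + -(a * s) by ring, Real.exp_add, Real.exp_add]
    ring
  have hnonneg : ∀ s, 0 ≤ s → s * (s ^ 2 - s₀ ^ 2) * (F (s + m) - F (-s + m)) ≤ 0 := by
    intro s hs
    rcases le_total s s₀ with h | h
    · have h1 : F (-s + m) ≤ F (s + m) := hFle _ _ (by linarith [hdiff s, hpos s hs h])
      exact mul_nonpos_of_nonpos_of_nonneg
        (mul_nonpos_of_nonneg_of_nonpos hs (by nlinarith)) (by linarith)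
    · have h1 : F (s + m) ≤ F (-s + m) := hFle _ _ (by linarith [hdiff s, hneg s h])
      exact mul_nonpos_of_nonneg_of_nonpos (mul_nonneg hs (by nlinarith)) (by linarith)
  have hsum : (∫ s, s * (s ^ 2 - s₀ ^ 2) * F (s + m)) +
      (∫ s, (-s) * ((-s) ^ 2 - s₀ ^ 2) * F (-s + m)) ≤ 0 := by
    rw [← integral_add hInt hInt']
    refine integral_nonpos fun s => ?_
    simp only [Pi.zero_apply]
    rcases le_total 0 s with hs | hs
    · linarith [hnonneg s hs]
    · have := hnonneg (-s) (by linarith)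
      rw [neg_neg] at this
      linarith
  rw [← hsym] at hsum
  linarith

lemma tiltMoment_hankel_nonneg (a θ : ℝ) :
    0 ≤ tiltMoment a 2 θ * tiltMoment a 0 θ - tiltMoment a 1 θ ^ 2 := by
  have h0 := tiltMoment_zero_pos a θ
  set c := tiltMoment a 1 θ / tiltMoment a 0 θ with hc
  have e : ∫ x, (x - c) ^ 2 * Real.exp (θ * x) * Real.exp (-Real.exp (a * x)) ∂(gaussianReal 0 1)
      = tiltMoment a 2 θ - 2 * c * tiltMoment a 1 θ + c ^ 2 * tiltMoment a 0 θ := by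
    have i0 := (integrable_tiltMoment a 0 θ).const_mul (c ^ 2)
    have i1 := (integrable_tiltMoment a 1 θ).const_mul (2 * c)
    have i2 := integrable_tiltMoment a 2 θ
    have i21 := i2.sub i1
    simp only [Pi.sub_def] at i21
    unfold tiltMoment
    rw [← integral_const_mul, ← integral_const_mul, ← integral_sub i2 i1, ← integral_add i21 i0]
    refine integral_congr_ae (Filter.Eventually.of_forall fun x => ?_)
    ring
  have hnn : 0 ≤ tiltMoment a 2 θ - 2 * c * tiltMoment a 1 θ + c ^ 2 * tiltMoment a 0 θ := by
    rw [← e]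
    exact integral_nonneg fun x => by positivity
  have hc1 : tiltMoment a 1 θ = c * tiltMoment a 0 θ := by rw [hc]; field_simp
  rw [hc1] at hnn ⊢
  nlinarith [mul_nonneg hnn h0.le]

lemma tiltMoment_third_cumulant_nonpos {a : ℝ} (ha : 0 < a) (θ : ℝ) :
    tiltMoment a 3 θ * tiltMoment a 0 θ ^ 2 - 3 * tiltMoment a 2 θ * tiltMoment a 1 θ *
      tiltMoment a 0 θ + 2 * tiltMoment a 1 θ ^ 3 ≤ 0 := by
  have h0 := tiltMoment_zero_pos a θ
  set c := tiltMoment a 1 θ / tiltMoment a 0 θ with hc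
  have hc1 : tiltMoment a 1 θ = c * tiltMoment a 0 θ := by rw [hc]; field_simp
  have i0 := integrable_tiltMoment a 0 θ
  have i1 := integrable_tiltMoment a 1 θ
  have i2 := integrable_tiltMoment a 2 θ
  have i3 := integrable_tiltMoment a 3 θ
  have j1 : Integrable (fun x => (x - c) * Real.exp (θ * x) * Real.exp (-Real.exp (a * x)))
      (gaussianReal 0 1) := by
    refine (i1.sub (i0.const_mul c)).congr (Filter.Eventually.of_forall fun x => ?_)
    simp only [Pi.sub_apply]
    ring
  have j3 : Integrable (fun x => (x - c) ^ 3 * Real.exp (θ * x) * Real.exp (-Real.exp (a * x)))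
      (gaussianReal 0 1) := by
    refine (((i3.sub (i2.const_mul (3 * c))).add (i1.const_mul (3 * c ^ 2))).sub
      (i0.const_mul (c ^ 3))).congr (Filter.Eventually.of_forall fun x => ?_)
    simp only [Pi.sub_apply, Pi.add_apply]
    ring
  have e1 : ∫ x, (x - c) * Real.exp (θ * x) * Real.exp (-Real.exp (a * x)) ∂(gaussianReal 0 1)
      = tiltMoment a 1 θ - c * tiltMoment a 0 θ := by
    unfold tiltMoment
    rw [← integral_const_mul, ← integral_sub i1 (i0.const_mul _)]
    refine integral_congr_ae (Filter.Eventually.of_forall fun x => ?_)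
    ring
  have e3 : ∫ x, (x - c) ^ 3 * Real.exp (θ * x) * Real.exp (-Real.exp (a * x))
      ∂(gaussianReal 0 1) = tiltMoment a 3 θ - 3 * c * tiltMoment a 2 θ +
        3 * c ^ 2 * tiltMoment a 1 θ - c ^ 3 * tiltMoment a 0 θ := by
    have i32 := i3.sub (i2.const_mul (3 * c))
    simp only [Pi.sub_def] at i32
    have i321 := i32.add (i1.const_mul (3 * c ^ 2))
    simp only [Pi.add_def] at i321
    unfold tiltMoment
    rw [← integral_const_mul, ← integral_const_mul, ← integral_const_mul,
      ← integral_sub i3 (i2.const_mul _), ← integral_add i32 (i1.const_mul _),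
      ← integral_sub i321 (i0.const_mul _)]
    refine integral_congr_ae (Filter.Eventually.of_forall fun x => ?_)
    ring
  have hle := third_central_moment_nonpos ha θ c (by rw [e1, hc1]; ring) j1 j3
  rw [e3] at hle
  rw [hc1] at hle ⊢
  nlinarith [mul_nonneg (neg_nonneg.2 hle) (sq_nonneg (tiltMoment a 0 θ))]

/-- The mean of the exponentially tilted law, i.e. the derivative of its cumulant generating
function. -/
def tiltMean (a θ : ℝ) : ℝ := tiltMoment a 1 θ / tiltMoment a 0 θ

/-- The variance of the exponentially tilted law. -/
def tiltVar (a θ : ℝ) : ℝ :=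
  (tiltMoment a 2 θ * tiltMoment a 0 θ - tiltMoment a 1 θ * tiltMoment a 1 θ) /
    tiltMoment a 0 θ ^ 2

lemma hasDerivAt_tiltMean (a θ : ℝ) : HasDerivAt (tiltMean a) (tiltVar a θ) θ :=
  (hasDerivAt_tiltMoment a 1 θ).div (hasDerivAt_tiltMoment a 0 θ) (tiltMoment_zero_pos a θ).ne'

lemma tiltMean_monotone (a : ℝ) : Monotone (tiltMean a) := by
  refine monotone_of_deriv_nonneg (fun θ => (hasDerivAt_tiltMean a θ).differentiableAt) fun θ => ?_
  rw [(hasDerivAt_tiltMean a θ).deriv, tiltVar]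
  have := tiltMoment_hankel_nonneg a θ
  exact div_nonneg (by linarith) (sq_nonneg _)

lemma tiltVar_antitone {a : ℝ} (ha : 0 < a) : Antitone (tiltVar a) := by
  have hd : ∀ θ, HasDerivAt (tiltVar a) _ θ := fun θ =>
    (((hasDerivAt_tiltMoment a 2 θ).mul (hasDerivAt_tiltMoment a 0 θ)).sub
      ((hasDerivAt_tiltMoment a 1 θ).mul (hasDerivAt_tiltMoment a 1 θ))).div
      ((hasDerivAt_tiltMoment a 0 θ).pow 2) (pow_pos (tiltMoment_zero_pos a θ) 2).ne'
  refine antitone_of_deriv_nonpos (fun θ => (hd θ).differentiableAt) fun θ => ?_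
  rw [(hd θ).deriv]
  have h := tiltMoment_third_cumulant_nonpos ha θ
  have h0 := tiltMoment_zero_pos a θ
  refine div_nonpos_of_nonpos_of_nonneg ?_ (by positivity)
  simp only [Pi.mul_apply, Pi.sub_apply]
  norm_num
  nlinarith [mul_nonneg (neg_nonneg.2 h) h0.le]

lemma gumbelMoment_eq {a : ℝ} (ha : 0 < a) (m : ℕ) (y : ℝ) :
    gumbelMoment a m y = Real.exp (-(y / a) ^ 2 / 2) * tiltMoment a 0 (y / a + a * m) := by
  unfold gumbelMoment tiltMoment
  rw [integral_gaussianReal_eq_integral_smul one_ne_zero,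
    integral_gaussianReal_eq_integral_smul one_ne_zero, ← integral_const_mul,
    ← integral_add_right_eq_self _ (-(y / a))]
  refine integral_congr_ae (Filter.Eventually.of_forall fun x => ?_)
  simp only [smul_eq_mul, gaussianPDFReal, NNReal.coe_one, mul_one, sub_zero, pow_zero, one_mul]
  have e : y + a * (x + -(y / a)) = a * x := by field_simp; ring
  rw [e]
  simp only [mul_assoc, ← Real.exp_add]
  rw [mul_left_comm (Real.exp _), ← Real.exp_add]
  congr 2
  field_simp
  ring

lemma gumbelMoment_pos {a : ℝ} (ha : 0 < a) (m : ℕ) (y : ℝ) : 0 < gumbelMoment a m y := by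
  rw [gumbelMoment_eq ha]
  exact mul_pos (Real.exp_pos _) (tiltMoment_zero_pos _ _)

/-- The hazard rate of the sum of a Gumbel and a Gaussian variable. -/
def hazard (a y : ℝ) : ℝ := gumbelMoment a 1 y / gumbelMoment a 0 y

lemma hazard_pos {a : ℝ} (ha : 0 < a) (y : ℝ) : 0 < hazard a y :=
  div_pos (gumbelMoment_pos ha 1 y) (gumbelMoment_pos ha 0 y)

lemma hasDerivAt_log_hazard {a : ℝ} (ha : 0 < a) (y : ℝ) :
    HasDerivAt (fun y => Real.log (hazard a y))
      ((tiltMean a (y / a + a) - tiltMean a (y / a)) / a) y := by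
  have hlog : ∀ θ, HasDerivAt (fun θ => Real.log (tiltMoment a 0 θ)) (tiltMean a θ) θ := fun θ =>
    (hasDerivAt_tiltMoment a 0 θ).log (tiltMoment_zero_pos a θ).ne'
  have hfun : (fun y => Real.log (hazard a y)) = fun y =>
      Real.log (tiltMoment a 0 (y / a + a)) - Real.log (tiltMoment a 0 (y / a)) := by
    funext y
    rw [hazard, gumbelMoment_eq ha, gumbelMoment_eq ha,
      mul_div_mul_left _ _ (Real.exp_pos _).ne', Real.log_div (tiltMoment_zero_pos _ _).ne'
        (tiltMoment_zero_pos _ _).ne']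
    simp
  have h1 : HasDerivAt (fun y => y / a) (1 / a) y := (hasDerivAt_id y).div_const a
  have h2 : HasDerivAt (fun y => y / a + a) (1 / a) y := h1.add_const a
  rw [hfun]
  refine (((hlog _).comp y h2).sub ((hlog _).comp y h1)).congr_deriv ?_
  ring

lemma hazard_monotone {a : ℝ} (ha : 0 < a) : Monotone (hazard a) := by
  have hlog : Monotone fun y => Real.log (hazard a y) := by
    refine monotone_of_deriv_nonneg
      (fun y => (hasDerivAt_log_hazard ha y).differentiableAt) fun y => ?_
    rw [(hasDerivAt_log_hazard ha y).deriv]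
    exact div_nonneg (sub_nonneg.2 (tiltMean_monotone a (by linarith))) ha.le
  intro x y hxy
  exact (Real.log_le_log_iff (hazard_pos ha x) (hazard_pos ha y)).1 (hlog hxy)

/-- The hazard rate is log-concave. -/
lemma hazard_cross {a : ℝ} (ha : 0 < a) {c c' y y' : ℝ} (hc : c' ≤ c) (hy : y ≤ y') :
    hazard a (y + c') * hazard a (y' + c) ≤ hazard a (y' + c') * hazard a (y + c) := by
  have hd : Antitone fun θ => tiltMean a (θ + a) - tiltMean a θ := by
    have hd1 : ∀ θ, HasDerivAt (fun θ => tiltMean a (θ + a) - tiltMean a θ)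
        (tiltVar a (θ + a) - tiltVar a θ) θ := fun θ =>
      ((hasDerivAt_tiltMean a (θ + a)).comp_add_const θ a).sub (hasDerivAt_tiltMean a θ)
    refine antitone_of_deriv_nonpos (fun θ => (hd1 θ).differentiableAt) fun θ => ?_
    rw [(hd1 θ).deriv]
    exact sub_nonpos.2 (tiltVar_antitone ha (by linarith))
  have hmono : Monotone fun y => Real.log (hazard a (y + c')) - Real.log (hazard a (y + c)) := by
    have hd2 : ∀ y, HasDerivAt
        (fun y => Real.log (hazard a (y + c')) - Real.log (hazard a (y + c))) _ y := fun y =>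
      ((hasDerivAt_log_hazard ha (y + c')).comp_add_const y c').sub
        ((hasDerivAt_log_hazard ha (y + c)).comp_add_const y c)
    refine monotone_of_deriv_nonneg (fun y => (hd2 y).differentiableAt) fun y => ?_
    rw [(hd2 y).deriv]
    refine sub_nonneg.2 (div_le_div_of_nonneg_right ?_ ha.le)
    exact hd (div_le_div_of_nonneg_right (by linarith) ha.le)
  have h := hmono hy
  simp only at h
  have p := hazard_pos ha
  rw [← Real.log_le_log_iff (mul_pos (p _) (p _)) (mul_pos (p _) (p _)),
    Real.log_mul (p _).ne' (p _).ne', Real.log_mul (p _).ne' (p _).ne']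
  linarith

lemma hasDerivAt_gumbelMoment_zero (a y : ℝ) :
    HasDerivAt (gumbelMoment a 0) (-gumbelMoment a 1 y) y := by
  have h := hasDerivAt_integral_of_dominated_loc_of_deriv_le (μ := gaussianReal 0 1) (𝕜 := ℝ)
    (F := fun y x => Real.exp (((0 : ℕ) : ℝ) * (y + a * x) - Real.exp (y + a * x)))
    (F' := fun y x => -Real.exp (((1 : ℕ) : ℝ) * (y + a * x) - Real.exp (y + a * x)))
    (x₀ := y) (s := Set.univ) (bound := fun _ => 1) Filter.univ_mem
    (Filter.Eventually.of_forall fun z => by fun_prop)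
    (by
      refine (integrable_const (1 : ℝ)).mono' (by fun_prop)
        (Filter.Eventually.of_forall fun x => ?_)
      simpa using (Real.exp_pos _).le)
    (by fun_prop)
    (Filter.Eventually.of_forall fun x z _ => by
      rw [norm_neg, Real.norm_of_nonneg (Real.exp_pos _).le, Real.exp_le_one_iff]
      have := Real.add_one_le_exp (z + a * x)
      push_cast
      linarith)
    (integrable_const _)
    (Filter.Eventually.of_forall fun x z _ => by
      have h1 : HasDerivAt (fun z => z + a * x) 1 z := (hasDerivAt_id z).add_const _
      have h2 := (h1.exp.neg).exp
      refine HasDerivAt.congr_deriv (f := fun z => Real.exp (-Real.exp (z + a * x))) h2 ?_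
        |>.congr_of_eventuallyEq (Filter.Eventually.of_forall fun z => by simp)
      rw [Nat.cast_one, one_mul, sub_eq_add_neg, Real.exp_add (z + a * x) (-_)]
      simp only [Pi.neg_apply]
      ring)
  refine h.2.congr_deriv ?_
  rw [integral_neg]
  rfl

/-- The survival function is log-concave. -/
lemma gumbelMoment_zero_cross {a : ℝ} (ha : 0 < a) {c c' y y' : ℝ} (hc : c' ≤ c) (hy : y ≤ y') :
    gumbelMoment a 0 (y + c') * gumbelMoment a 0 (y' + c) ≤
      gumbelMoment a 0 (y' + c') * gumbelMoment a 0 (y + c) := by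
  have p := gumbelMoment_pos ha 0
  have hlog : ∀ y, HasDerivAt (fun y => Real.log (gumbelMoment a 0 y)) (-hazard a y) y := fun y =>
    ((hasDerivAt_gumbelMoment_zero a y).log (p y).ne').congr_deriv (by rw [hazard, neg_div])
  have hd : ∀ y, HasDerivAt (fun y => Real.log (gumbelMoment a 0 (y + c')) -
      Real.log (gumbelMoment a 0 (y + c))) (-hazard a (y + c') - -hazard a (y + c)) y := fun y =>
    ((hlog (y + c')).comp_add_const y c').sub ((hlog (y + c)).comp_add_const y c)
  have hmono : Monotone fun y => Real.log (gumbelMoment a 0 (y + c')) -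
      Real.log (gumbelMoment a 0 (y + c)) := by
    refine monotone_of_deriv_nonneg (fun y => (hd y).differentiableAt) fun y => ?_
    rw [(hd y).deriv]
    have := hazard_monotone ha (show y + c' ≤ y + c by linarith)
    linarith
  have h := hmono hy
  simp only at h
  rw [← Real.log_le_log_iff (mul_pos (p _) (p _)) (mul_pos (p _) (p _)),
    Real.log_mul (p _).ne' (p _).ne', Real.log_mul (p _).ne' (p _).ne']
  linarith

/-- An integral form of Chebyshev's association inequality. -/
lemma integral_mul_integral_le_of_cross {X : Type*} [MeasurableSpace X] {μ : Measure X}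
    {f w w' : X → ℝ} (hw : Integrable w μ) (hw' : Integrable w' μ)
    (hfw : Integrable (fun x => f x * w x) μ) (hfw' : Integrable (fun x => f x * w' x) μ)
    {s : Set X} (hs : ∀ᵐ x ∂μ, x ∈ s)
    (h : ∀ x ∈ s, ∀ y ∈ s, 0 ≤ (f x - f y) * (w' x * w y - w' y * w x)) :
    (∫ x, f x * w x ∂μ) * (∫ x, w' x ∂μ) ≤ (∫ x, w x ∂μ) * (∫ x, f x * w' x ∂μ) := by
  have inner : ∀ y ∈ s, 0 ≤ (∫ x, f x * w' x ∂μ) * w y - (∫ x, f x * w x ∂μ) * w' y -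
      (∫ x, w' x ∂μ) * (f y * w y) + (∫ x, w x ∂μ) * (f y * w' y) := by
    intro y hy
    have i12 := (hfw'.mul_const (w y)).sub (hfw.mul_const (w' y))
    simp only [Pi.sub_def] at i12
    have i123 := i12.sub (hw'.mul_const (f y * w y))
    simp only [Pi.sub_def] at i123
    rw [← integral_mul_const, ← integral_mul_const, ← integral_mul_const, ← integral_mul_const,
      ← integral_sub (hfw'.mul_const _) (hfw.mul_const _), ← integral_sub i12 (hw'.mul_const _),
      ← integral_add i123 (hw.mul_const _)]
    refine integral_nonneg_of_ae ?_
    filter_upwards [hs] with x hx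
    have := h x hx y hy
    simp only [Pi.zero_apply]
    linarith
  have i12 := (hw.const_mul (∫ x, f x * w' x ∂μ)).sub (hw'.const_mul (∫ x, f x * w x ∂μ))
  simp only [Pi.sub_def] at i12
  have i123 := i12.sub (hfw.const_mul (∫ x, w' x ∂μ))
  simp only [Pi.sub_def] at i123
  have outer : 0 ≤ ∫ y, ((∫ x, f x * w' x ∂μ) * w y - (∫ x, f x * w x ∂μ) * w' y -
      (∫ x, w' x ∂μ) * (f y * w y) + (∫ x, w x ∂μ) * (f y * w' y)) ∂μ := by
    refine integral_nonneg_of_ae ?_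
    filter_upwards [hs] with y hy using inner y hy
  rw [integral_add i123 (hfw'.const_mul _), integral_sub i12 (hfw.const_mul _),
    integral_sub (hw.const_mul _) (hw'.const_mul _), integral_const_mul, integral_const_mul,
    integral_const_mul, integral_const_mul] at outer
  linarith

/-- The softmax map. -/
def softmax {I : ℕ} (w : Fin I → ℝ) (j : Fin I) : ℝ :=
  Real.exp (w j) / ∑ l, Real.exp (w l)

section Softmax

variable {I : ℕ}

lemma sum_exp_pos (w : Fin I → ℝ) (j : Fin I) : 0 < ∑ l, Real.exp (w l) :=
  Finset.sum_pos (fun _ _ => Real.exp_pos _) ⟨j, Finset.mem_univ j⟩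

lemma softmax_pos (w : Fin I → ℝ) (j : Fin I) : 0 < softmax w j :=
  div_pos (Real.exp_pos _) (sum_exp_pos w j)

lemma sum_softmax (w : Fin I → ℝ) (j : Fin I) : ∑ k, softmax w k = 1 := by
  simp only [softmax]
  rw [← Finset.sum_div, div_self (sum_exp_pos w j).ne']

lemma softmax_le_one (w : Fin I → ℝ) (j : Fin I) : softmax w j ≤ 1 := by
  rw [← sum_softmax w j]
  exact Finset.single_le_sum (fun k _ => (softmax_pos w k).le) (Finset.mem_univ j)

lemma softmax_add_const (w : Fin I → ℝ) (c : ℝ) (j : Fin I) :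
    softmax (fun k => w k + c) j = softmax w j := by
  simp only [softmax, Real.exp_add, ← Finset.sum_mul]
  exact mul_div_mul_right _ _ (Real.exp_pos c).ne'

lemma continuous_softmax (j : Fin I) : Continuous fun w : Fin I → ℝ => softmax w j := by
  unfold softmax
  exact (by fun_prop : Continuous fun w : Fin I → ℝ => Real.exp (w j)).div (by fun_prop)
    fun w => (sum_exp_pos w j).ne'

instance : IsProbabilityMeasure (_root_.stdGaussian I) := by
  unfold _root_.stdGaussian; infer_instance

/-- The choice probabilities given prices `d` and taste shocks `x`. -/
def choiceProb (a : ℝ) (d x : Fin I → ℝ) (j : Fin I) : ℝ :=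
  softmax (fun k => a * (d k + x k)) j

lemma continuous_choiceProb (a : ℝ) (d : Fin I → ℝ) (j : Fin I) :
    Continuous fun x => choiceProb a d x j :=
  (continuous_softmax j).comp (by fun_prop)

lemma choiceProb_pos (a : ℝ) (d x : Fin I → ℝ) (j : Fin I) : 0 < choiceProb a d x j :=
  softmax_pos _ _

lemma choiceProb_le_one (a : ℝ) (d x : Fin I → ℝ) (j : Fin I) : choiceProb a d x j ≤ 1 :=
  softmax_le_one _ _

lemma sum_choiceProb (a : ℝ) (d x : Fin I → ℝ) (j : Fin I) : ∑ k, choiceProb a d x k = 1 :=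
  sum_softmax _ j

lemma integrable_choiceProb (a : ℝ) (d : Fin I → ℝ) (j : Fin I) :
    Integrable (fun x => choiceProb a d x j) (_root_.stdGaussian I) :=
  (integrable_const (1 : ℝ)).mono' (continuous_choiceProb a d j).aestronglyMeasurable
    (Filter.Eventually.of_forall fun x => by
      rw [Real.norm_of_nonneg (choiceProb_pos a d x j).le]; exact choiceProb_le_one a d x j)

lemma integrable_choiceProb_mul (a : ℝ) (d : Fin I → ℝ) (i j : Fin I) :
    Integrable (fun x => choiceProb a d x i * choiceProb a d x j) (_root_.stdGaussian I) :=
  (integrable_choiceProb a d i).mul_bdd (c := 1)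
    (continuous_choiceProb a d j).aestronglyMeasurable
    (Filter.Eventually.of_forall fun x => by
      rw [Real.norm_of_nonneg (choiceProb_pos a d x j).le]; exact choiceProb_le_one a d x j)

/-- Average choice probabilities. -/
def share (a : ℝ) (d : Fin I → ℝ) (j : Fin I) : ℝ := ∫ x, choiceProb a d x j ∂(_root_.stdGaussian I)

/-- Average products of choice probabilities. -/
def pairShare (a : ℝ) (d : Fin I → ℝ) (i j : Fin I) : ℝ :=
  ∫ x, choiceProb a d x i * choiceProb a d x j ∂(_root_.stdGaussian I)

lemma integral_pos_of_forall_pos {f : (Fin I → ℝ) → ℝ} (hf : Integrable f (_root_.stdGaussian I))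
    (h : ∀ x, 0 < f x) : 0 < ∫ x, f x ∂(_root_.stdGaussian I) := by
  rw [integral_pos_iff_support_of_nonneg (fun x => (h x).le) hf,
    Function.support_eq_univ fun x => (h x).ne']
  simp

lemma share_pos (a : ℝ) (d : Fin I → ℝ) (j : Fin I) : 0 < share a d j :=
  integral_pos_of_forall_pos (integrable_choiceProb a d j) fun x => choiceProb_pos a d x j

lemma pairShare_pos (a : ℝ) (d : Fin I → ℝ) (i j : Fin I) : 0 < pairShare a d i j :=
  integral_pos_of_forall_pos (integrable_choiceProb_mul a d i j) fun x =>
    mul_pos (choiceProb_pos a d x i) (choiceProb_pos a d x j)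

/-- Random utility representation of the moments of the choice probabilities. -/
lemma integral_prod_choiceProb_pow (a : ℝ) (d : Fin I → ℝ) (e : Fin I → ℕ) {m : ℕ}
    (hm : 0 < m) (hm' : Real.Gamma m = 1) (he : ∑ k, e k = m) :
    IntegrableOn (fun t => (∏ k, gumbelMoment a (e k) (Real.log t + a * d k)) * t⁻¹)
      (Set.Ioi 0) ∧
    ∫ x, ∏ k, choiceProb a d x k ^ e k ∂(_root_.stdGaussian I) =
      ∫ t in Set.Ioi 0, (∏ k, gumbelMoment a (e k) (Real.log t + a * d k)) * t⁻¹ := by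
  have hne : ∃ j : Fin I, True := by
    by_contra hcon
    push Not at hcon
    rw [Finset.sum_eq_zero fun k _ => (hcon k).elim] at he
    omega
  obtain ⟨j, -⟩ := hne
  set ν : Measure ℝ := volume.restrict (Set.Ioi 0) with hν
  set F : (Fin I → ℝ) → ℝ → ℝ := fun x t =>
    (∏ k, Real.exp (e k * ((Real.log t + a * d k) + a * x k) -
      Real.exp ((Real.log t + a * d k) + a * x k))) * t⁻¹ with hF
  have hFt : ∀ x, ∀ t ∈ Set.Ioi (0 : ℝ), F x t = (∏ k, Real.exp (a * (d k + x k)) ^ e k) *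
      (t ^ ((m : ℝ) - 1) * Real.exp (-((∑ k, Real.exp (a * (d k + x k))) * t))) := by
    intro x t ht
    have ht : 0 < t := ht
    have h1 : ∀ k, Real.exp (e k * ((Real.log t + a * d k) + a * x k) -
        Real.exp ((Real.log t + a * d k) + a * x k)) =
        t ^ e k * (Real.exp (a * (d k + x k)) ^ e k * Real.exp (-(Real.exp (a * (d k + x k)) * t)))
        := by
      intro k
      have h2 : Real.exp ((Real.log t + a * d k) + a * x k) =
          t * Real.exp (a * (d k + x k)) := by
        rw [add_assoc, Real.exp_add, Real.exp_log ht, mul_add]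
      rw [sub_eq_add_neg, Real.exp_add, Real.exp_nat_mul, h2, mul_pow, mul_assoc,
        mul_comm t (Real.exp _)]
    simp only [hF, h1]
    rw [Finset.prod_mul_distrib, Finset.prod_mul_distrib, Finset.prod_pow_eq_pow_sum, he,
      ← Real.exp_sum, Finset.sum_neg_distrib, ← Finset.sum_mul, Real.rpow_sub_one ht.ne',
      Real.rpow_natCast]
    field_simp
  have hin : ∀ x, ∫ t, F x t ∂ν = ∏ k, choiceProb a d x k ^ e k := by
    intro x
    have hZ := sum_exp_pos (fun k => a * (d k + x k)) j
    rw [hν, setIntegral_congr_fun measurableSet_Ioi (hFt x), integral_const_mul,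
      Real.integral_rpow_mul_exp_neg_mul_Ioi (by exact_mod_cast hm) hZ, hm', mul_one,
      Real.rpow_natCast]
    simp only [choiceProb, softmax, div_pow]
    rw [Finset.prod_div_distrib, Finset.prod_pow_eq_pow_sum, he, one_pow, mul_one_div]
  have hpos : ∀ x, 0 < ∏ k, choiceProb a d x k ^ e k := fun x =>
    Finset.prod_pos fun k _ => pow_pos (choiceProb_pos a d x k) _
  have hmeas : Measurable (Function.uncurry F) := by
    simp only [hF, Function.uncurry_def]
    fun_prop
  have hnorm : ∀ x, ∫ t, ‖F x t‖ ∂ν = ∏ k, choiceProb a d x k ^ e k := by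
    intro x
    rw [← hin x, hν]
    refine setIntegral_congr_fun measurableSet_Ioi fun t ht => ?_
    have ht : 0 < t := ht
    exact Real.norm_of_nonneg (mul_nonneg (Finset.prod_nonneg fun k _ => (Real.exp_pos _).le)
      (inv_nonneg.2 ht.le))
  have hInt : Integrable (Function.uncurry F) ((_root_.stdGaussian I).prod ν) := by
    rw [integrable_prod_iff hmeas.aestronglyMeasurable]
    refine ⟨Filter.Eventually.of_forall fun x => ?_, ?_⟩
    · exact Integrable.of_integral_ne_zero (by
        show ∫ t, F x t ∂ν ≠ 0
        rw [hin x]; exact (hpos x).ne')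
    · show Integrable (fun x => ∫ t, ‖F x t‖ ∂ν) _
      simp only [hnorm]
      refine (integrable_const (1 : ℝ)).mono' ?_ (Filter.Eventually.of_forall fun x => ?_)
      · exact (continuous_finsetProd _ fun k _ =>
          (continuous_choiceProb a d k).pow _).aestronglyMeasurable
      · rw [Real.norm_of_nonneg (hpos x).le]
        exact Finset.prod_le_one (fun k _ => (pow_pos (choiceProb_pos a d x k) _).le)
          fun k _ => pow_le_one₀ (choiceProb_pos a d x k).le (choiceProb_le_one a d x k)
  have hout : ∀ t, ∫ x, F x t ∂(_root_.stdGaussian I) =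
      (∏ k, gumbelMoment a (e k) (Real.log t + a * d k)) * t⁻¹ := by
    intro t
    simp only [hF]
    rw [integral_mul_const]
    congr 1
    exact integral_fintype_prod_eq_prod (fun k z =>
      Real.exp (e k * ((Real.log t + a * d k) + a * z) -
        Real.exp ((Real.log t + a * d k) + a * z)))
  constructor
  · have := hInt.integral_prod_right
    exact this.congr (Filter.Eventually.of_forall hout)
  · calc _ = ∫ x, ∫ t, F x t ∂ν ∂(_root_.stdGaussian I) := by simp only [hin]
      _ = ∫ t, ∫ x, F x t ∂(_root_.stdGaussian I) ∂ν := integral_integral_swap hInt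
      _ = _ := by simp only [hout]

/-- The density, over the transformed winning utility `t`, of alternative `j` being chosen. -/
def shareDensity (a : ℝ) (d : Fin I → ℝ) (j : Fin I) (t : ℝ) : ℝ :=
  hazard a (Real.log t + a * d j) * (∏ k, gumbelMoment a 0 (Real.log t + a * d k)) * t⁻¹

lemma share_eq_integral {a : ℝ} (ha : 0 < a) (d : Fin I → ℝ) (j : Fin I) :
    IntegrableOn (shareDensity a d j) (Set.Ioi 0) ∧
    share a d j = ∫ t in Set.Ioi 0, shareDensity a d j t := by
  have h := integral_prod_choiceProb_pow a d (fun k => if k = j then 1 else 0) one_pos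
    (by simp) (by simp)
  have h1 : ∀ t, (∏ k, gumbelMoment a (if k = j then 1 else 0) (Real.log t + a * d k)) * t⁻¹ =
      shareDensity a d j t := by
    intro t
    have h2 : ∀ k, gumbelMoment a (if k = j then 1 else 0) (Real.log t + a * d k) =
        (if k = j then hazard a (Real.log t + a * d k) else 1) *
          gumbelMoment a 0 (Real.log t + a * d k) := by
      intro k
      split_ifs
      · rw [hazard, div_mul_cancel₀ _ (gumbelMoment_pos ha 0 _).ne']
      · rw [one_mul]
    simp only [h2, Finset.prod_mul_distrib, Finset.prod_ite_eq', Finset.mem_univ, if_true,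
      shareDensity]
  simp only [h1, pow_ite, pow_one, pow_zero, Finset.prod_ite_eq', Finset.mem_univ, if_true] at h
  exact h

lemma pairShare_eq_integral_prod (a : ℝ) (d : Fin I → ℝ) (i j : Fin I) :
    IntegrableOn (fun t => (∏ k, gumbelMoment a ((if k = i then 1 else 0) + if k = j then 1 else 0)
      (Real.log t + a * d k)) * t⁻¹) (Set.Ioi 0) ∧
    pairShare a d i j = ∫ t in Set.Ioi 0, (∏ k, gumbelMoment a
      ((if k = i then 1 else 0) + if k = j then 1 else 0) (Real.log t + a * d k)) * t⁻¹ := by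
  have h := integral_prod_choiceProb_pow a d
    (fun k => (if k = i then 1 else 0) + if k = j then 1 else 0) two_pos
    (by have := Real.Gamma_nat_eq_factorial 1; norm_num at this; simp)
    (by simp [Finset.sum_add_distrib])
  simp only [pow_add, Finset.prod_mul_distrib, pow_ite, pow_one, pow_zero,
    Finset.prod_ite_eq', Finset.mem_univ, if_true] at h
  exact h

lemma pairShare_eq_integral {a : ℝ} (ha : 0 < a) (d : Fin I → ℝ) {i j : Fin I} (hij : i ≠ j) :
    IntegrableOn (fun t => hazard a (Real.log t + a * d i) * shareDensity a d j t) (Set.Ioi 0) ∧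
    pairShare a d i j =
      ∫ t in Set.Ioi 0, hazard a (Real.log t + a * d i) * shareDensity a d j t := by
  have h := pairShare_eq_integral_prod a d i j
  have h1 : ∀ t, (∏ k, gumbelMoment a ((if k = i then 1 else 0) + if k = j then 1 else 0)
      (Real.log t + a * d k)) * t⁻¹ = hazard a (Real.log t + a * d i) * shareDensity a d j t := by
    intro t
    have h2 : ∀ k, gumbelMoment a ((if k = i then 1 else 0) + if k = j then 1 else 0)
        (Real.log t + a * d k) =
        (if k = i then hazard a (Real.log t + a * d k) else 1) *
        ((if k = j then hazard a (Real.log t + a * d k) else 1) *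
          gumbelMoment a 0 (Real.log t + a * d k)) := by
      intro k
      have hc : hazard a (Real.log t + a * d k) * gumbelMoment a 0 (Real.log t + a * d k) =
          gumbelMoment a 1 (Real.log t + a * d k) := by
        rw [hazard, div_mul_cancel₀ _ (gumbelMoment_pos ha 0 _).ne']
      by_cases hi : k = i
      · have hj : k ≠ j := fun h => hij (hi.symm.trans h)
        simp only [if_pos hi, if_neg hj, add_zero, one_mul, hc]
      · by_cases hj : k = j
        · simp only [if_neg hi, if_pos hj, zero_add, one_mul, hc]
        · simp only [if_neg hi, if_neg hj, add_zero, one_mul]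
    simp only [h2, Finset.prod_mul_distrib, Finset.prod_ite_eq', Finset.mem_univ, if_true,
      shareDensity]
    ring
  simp only [h1] at h
  exact h

/-- Lowering the attractiveness of the alternatives raises the relative substitution towards a
fixed alternative `i`. -/
lemma pairShare_mul_share_le {a : ℝ} (ha : 0 < a) {d d' : Fin I → ℝ} {i j j' : Fin I}
    (hij : i ≠ j) (hij' : i ≠ j') (hi : d' i = d i) (hd : ∀ k, d' k ≤ d k) (hj : d' j' ≤ d j) :
    pairShare a d i j * share a d' j' ≤ share a d j * pairShare a d' i j' := by
  obtain ⟨h1, e1⟩ := share_eq_integral ha d j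
  obtain ⟨h2, e2⟩ := share_eq_integral ha d' j'
  obtain ⟨h3, e3⟩ := pairShare_eq_integral ha d hij
  obtain ⟨h4, e4⟩ := pairShare_eq_integral ha d' hij'
  rw [hi] at h4 e4
  rw [e1, e2, e3, e4]
  refine integral_mul_integral_le_of_cross h1 h2 h3 h4 (s := Set.Ioi 0)
    (ae_restrict_mem measurableSet_Ioi) ?_
  have key : ∀ x y : ℝ, 0 < x → x ≤ y → shareDensity a d' j' x * shareDensity a d j y ≤
      shareDensity a d' j' y * shareDensity a d j x := by
    intro x y hx hxy
    have hlog := Real.log_le_log hx hxy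
    have hG := gumbelMoment_pos ha 0
    have hh := hazard_cross ha (mul_le_mul_of_nonneg_left hj ha.le) hlog
    have hP : (∏ k, gumbelMoment a 0 (Real.log x + a * d' k)) *
        (∏ k, gumbelMoment a 0 (Real.log y + a * d k)) ≤
        (∏ k, gumbelMoment a 0 (Real.log y + a * d' k)) *
        (∏ k, gumbelMoment a 0 (Real.log x + a * d k)) := by
      rw [← Finset.prod_mul_distrib, ← Finset.prod_mul_distrib]
      exact Finset.prod_le_prod (fun k _ => (mul_pos (hG _) (hG _)).le) fun k _ =>
        gumbelMoment_zero_cross ha (mul_le_mul_of_nonneg_left (hd k) ha.le) hlog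
    have hprod := mul_le_mul hh hP
      (mul_nonneg (Finset.prod_nonneg fun k _ => (hG _).le)
        (Finset.prod_nonneg fun k _ => (hG _).le))
      (mul_pos (hazard_pos ha _) (hazard_pos ha _)).le
    have := mul_le_mul_of_nonneg_right hprod
      (mul_nonneg (inv_nonneg.2 hx.le) (inv_nonneg.2 (hx.le.trans hxy)))
    simp only [shareDensity]
    linarith
  have mono : ∀ x y : ℝ, 0 < x → x ≤ y →
      hazard a (Real.log x + a * d i) ≤ hazard a (Real.log y + a * d i) := fun x y hx hxy =>
    hazard_monotone ha (by linarith [Real.log_le_log hx hxy])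
  intro x hx y hy
  rcases le_total x y with hxy | hxy
  · exact mul_nonneg_of_nonpos_of_nonpos (sub_nonpos.2 (mono x y hx hxy))
      (sub_nonpos.2 (key x y hx hxy))
  · exact mul_nonneg (sub_nonneg.2 (mono y x hy hxy)) (by linarith [key y x hy hxy])

/-- When the advantage of `i` over `j` equals the precision parameter, Gaussian exchangeability
identifies two second moments. -/
lemma pairShare_self_eq {a : ℝ} (ha : 0 < a) {d : Fin I → ℝ} {i j : Fin I} (hij : i ≠ j)
    (hd : d i = d j + a) : pairShare a d j j = pairShare a d i j := by
  rw [(pairShare_eq_integral_prod a d j j).2, (pairShare_eq_integral_prod a d i j).2]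
  congr 1
  funext t
  congr 1
  rw [← Finset.mul_prod_erase _ _ (Finset.mem_univ i),
    ← Finset.mul_prod_erase _ _ (Finset.mem_univ i),
    ← Finset.mul_prod_erase _ _ (Finset.mem_erase.2 ⟨hij.symm, Finset.mem_univ j⟩),
    ← Finset.mul_prod_erase _ _ (Finset.mem_erase.2 ⟨hij.symm, Finset.mem_univ j⟩),
    ← mul_assoc, ← mul_assoc]
  congr 1
  · simp only [if_neg hij, if_neg hij.symm, if_true]
    simp only [gumbelMoment_eq ha, hd]
    have e1 : (Real.log t + a * (d j + a)) / a = (Real.log t + a * d j) / a + a := by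
      field_simp
      ring
    rw [e1]
    push_cast
    simp only [add_zero, mul_zero, mul_one]
    rw [show ∀ r : ℝ, r + a + a = r + a * 2 by intro r; ring]
    ring
  · refine Finset.prod_congr rfl fun k hk => ?_
    have hkj : k ≠ j := Finset.ne_of_mem_erase hk
    have hki : k ≠ i := Finset.ne_of_mem_erase (Finset.mem_of_mem_erase hk)
    simp only [if_neg hkj, if_neg hki]

end Softmax

section Equilibrium

variable {I : ℕ}

lemma continuous_choiceProb_param (x : Fin I → ℝ) (j : Fin I) :
    Continuous fun q : ℝ × (Fin I → ℝ) => choiceProb q.1 q.2 x j :=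
  (continuous_softmax j).comp (by fun_prop)

lemma continuous_share (j : Fin I) :
    Continuous fun q : ℝ × (Fin I → ℝ) => share q.1 q.2 j := by
  refine continuous_of_dominated (bound := fun _ => 1)
    (fun q => (continuous_choiceProb q.1 q.2 j).aestronglyMeasurable)
    (fun q => Filter.Eventually.of_forall fun x => ?_) (integrable_const _)
    (Filter.Eventually.of_forall fun x => continuous_choiceProb_param x j)
  rw [Real.norm_of_nonneg (choiceProb_pos _ _ x j).le]
  exact choiceProb_le_one _ _ x j

lemma continuous_pairShare (i j : Fin I) :
    Continuous fun q : ℝ × (Fin I → ℝ) => pairShare q.1 q.2 i j := by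
  refine continuous_of_dominated (bound := fun _ => 1)
    (fun q => (integrable_choiceProb_mul q.1 q.2 i j).aestronglyMeasurable)
    (fun q => Filter.Eventually.of_forall fun x => ?_) (integrable_const _)
    (Filter.Eventually.of_forall fun x =>
      (continuous_choiceProb_param x i).mul (continuous_choiceProb_param x j))
  have hi := choiceProb_pos q.1 q.2 x i
  have hj := choiceProb_pos q.1 q.2 x j
  rw [Real.norm_of_nonneg (mul_pos hi hj).le]
  exact mul_le_one₀ (choiceProb_le_one _ _ x i) hj.le (choiceProb_le_one _ _ x j)

lemma sum_pairShare (a : ℝ) (d : Fin I → ℝ) (j : Fin I) :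
    ∑ k, pairShare a d k j = share a d j := by
  unfold pairShare share
  rw [← integral_finsetSum _ fun k _ => integrable_choiceProb_mul a d k j]
  refine integral_congr_ae (Filter.Eventually.of_forall fun x => ?_)
  simp only [← Finset.sum_mul, sum_choiceProb a d x j, one_mul]

lemma sum_share (a : ℝ) (d : Fin I → ℝ) (j : Fin I) : ∑ k, share a d k = 1 := by
  unfold share
  rw [← integral_finsetSum _ fun k _ => integrable_choiceProb a d k]
  simp [sum_choiceProb a d _ j]

lemma pairShare_le_share (a : ℝ) (d : Fin I → ℝ) (i j : Fin I) :
    pairShare a d i j ≤ share a d j := by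
  refine integral_mono (integrable_choiceProb_mul a d i j) (integrable_choiceProb a d j) fun x => ?_
  exact mul_le_of_le_one_left (choiceProb_pos a d x j).le (choiceProb_le_one a d x i)

lemma two_mul_pairShare_le (a : ℝ) (d : Fin I → ℝ) (i j : Fin I) :
    2 * pairShare a d i j ≤ pairShare a d i i + pairShare a d j j := by
  unfold pairShare
  rw [← integral_const_mul, ← integral_add (integrable_choiceProb_mul a d i i)
    (integrable_choiceProb_mul a d j j)]
  refine integral_mono ((integrable_choiceProb_mul a d i j).const_mul 2)
    ((integrable_choiceProb_mul a d i i).add (integrable_choiceProb_mul a d j j)) fun x => ?_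
  simp only
  nlinarith [sq_nonneg (choiceProb a d x i - choiceProb a d x j)]

/-- The symmetric profile: `0` at `i`, and `-p` elsewhere. -/
def symProfile (i : Fin I) (p : ℝ) : Fin I → ℝ := fun k => if k = i then 0 else -p

lemma continuous_symProfile (i : Fin I) : Continuous (symProfile i) := by
  refine continuous_pi fun k => ?_
  unfold symProfile
  split_ifs <;> fun_prop

lemma shareDensity_symProfile (a p : ℝ) {i j : Fin I} (hij : j ≠ i) (t : ℝ) :
    shareDensity a (symProfile i p) j t = hazard a (Real.log t + a * -p) *
      (gumbelMoment a 0 (Real.log t) * gumbelMoment a 0 (Real.log t + a * -p) ^ (I - 1)) * t⁻¹ := by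
  rw [shareDensity, ← Finset.mul_prod_erase _ _ (Finset.mem_univ i),
    Finset.prod_congr rfl (g := fun _ => gumbelMoment a 0 (Real.log t + a * -p))]
  · rw [Finset.prod_const, Finset.card_erase_of_mem (Finset.mem_univ i), Finset.card_univ,
      Fintype.card_fin]
    simp [symProfile, hij]
  · intro k hk
    simp [symProfile, Finset.ne_of_mem_erase hk]

lemma share_symProfile {a : ℝ} (ha : 0 < a) (p : ℝ) {i j i' j' : Fin I} (hij : j ≠ i)
    (hij' : j' ≠ i') : share a (symProfile i p) j = share a (symProfile i' p) j' := by
  rw [(share_eq_integral ha _ j).2, (share_eq_integral ha _ j').2]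
  simp only [shareDensity_symProfile a p hij, shareDensity_symProfile a p hij']

lemma pairShare_symProfile {a : ℝ} (ha : 0 < a) (p : ℝ) {i j i' j' : Fin I} (hij : j ≠ i)
    (hij' : j' ≠ i') :
    pairShare a (symProfile i p) i j = pairShare a (symProfile i' p) i' j' := by
  rw [(pairShare_eq_integral ha _ hij.symm).2, (pairShare_eq_integral ha _ hij'.symm).2]
  simp only [shareDensity_symProfile a p hij, shareDensity_symProfile a p hij', symProfile, if_true]

lemma share_symProfile_le {a : ℝ} (ha : 0 < a) {i j : Fin I} (hij : j ≠ i) :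
    share a (symProfile i a) j ≤ I * pairShare a (symProfile i a) i j := by
  set P := pairShare a (symProfile i a) i j
  have hself : ∀ k, k ≠ i → pairShare a (symProfile i a) k k = P := fun k hk => by
    rw [pairShare_self_eq ha hk.symm (by simp [symProfile, hk]), pairShare_symProfile ha a hk hij]
  rw [← sum_pairShare]
  have : ∀ k ∈ Finset.univ, pairShare a (symProfile i a) k j ≤ P := by
    intro k _
    by_cases hk : k = i
    · rw [hk]
    · have := two_mul_pairShare_le a (symProfile i a) k j
      rw [hself k hk, hself j hij] at this
      linarith
  simpa using Finset.sum_le_card_nsmul _ _ _ this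

lemma exists_fixed_point (hI : 2 ≤ I) : ∃ a : ℝ, 0 < a ∧ ∀ i j : Fin I, j ≠ i →
    share a (symProfile i a) j = a ^ 2 * pairShare a (symProfile i a) i j := by
  let i₀ : Fin I := ⟨0, by omega⟩
  let j₀ : Fin I := ⟨1, by omega⟩
  have h₀ : j₀ ≠ i₀ := by simp [i₀, j₀]
  set g : ℝ → ℝ := fun a =>
    a ^ 2 * pairShare a (symProfile i₀ a) i₀ j₀ - share a (symProfile i₀ a) j₀ with hg
  have hpath : Continuous fun a : ℝ => (a, symProfile i₀ a) :=
    continuous_id.prodMk (continuous_symProfile i₀)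
  have hcont : Continuous g :=
    ((continuous_pow 2).mul ((continuous_pairShare i₀ j₀).comp hpath)).sub
      ((continuous_share j₀).comp hpath)
  have hI1 : (1 : ℝ) ≤ I := by exact_mod_cast (by omega : 1 ≤ I)
  have hs : 1 ≤ √(I : ℝ) := Real.one_le_sqrt.2 hI1
  have g1 : g 1 ≤ 0 := by
    have := pairShare_le_share 1 (symProfile i₀ 1) i₀ j₀
    simp only [hg]
    linarith
  have g2 : 0 ≤ g √(I : ℝ) := by
    have := share_symProfile_le (lt_of_lt_of_le one_pos hs) h₀
    simp only [hg, Real.sq_sqrt (by linarith : (0 : ℝ) ≤ I)]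
    linarith
  obtain ⟨a, ⟨ha1, -⟩, ha⟩ := intermediate_value_Icc hs hcont.continuousOn ⟨g1, g2⟩
  have ha0 : 0 < a := by linarith
  refine ⟨a, ha0, fun i j hij => ?_⟩
  rw [share_symProfile ha0 a hij h₀, pairShare_symProfile ha0 a hij h₀]
  simp only [hg] at ha
  linarith

/-- Moving the `j`-th coordinate of `d` by `s`. -/
def bump (d : Fin I → ℝ) (j : Fin I) (s : ℝ) : Fin I → ℝ := fun k => d k + if k = j then s else 0

lemma bump_zero (d : Fin I → ℝ) (j : Fin I) : bump d j 0 = d := by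
  funext k; simp [bump]

lemma hasDerivAt_choiceProb_bump (a : ℝ) (d x : Fin I → ℝ) (k j : Fin I) (s : ℝ) :
    HasDerivAt (fun s => choiceProb a (bump d j s) x k)
      (a * ((if k = j then choiceProb a (bump d j s) x k else 0) -
        choiceProb a (bump d j s) x k * choiceProb a (bump d j s) x j)) s := by
  have hw : ∀ l, HasDerivAt (fun s => Real.exp (a * (bump d j s l + x l)))
      (if l = j then a * Real.exp (a * (bump d j s l + x l)) else 0) s := by
    intro l
    by_cases hl : l = j
    · have h1 : HasDerivAt (fun s => a * (bump d j s l + x l)) a s := by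
        simp only [bump, hl, if_true]
        simpa using (((hasDerivAt_id s).const_add (d j)).add_const (x j)).const_mul a
      rw [if_pos hl, mul_comm]
      exact h1.exp
    · simp only [bump, hl, if_false]
      exact hasDerivAt_const _ _
  have hZ : HasDerivAt (fun s => ∑ l, Real.exp (a * (bump d j s l + x l)))
      (a * Real.exp (a * (bump d j s j + x j))) s := by
    have h := HasDerivAt.fun_sum (u := Finset.univ) fun l _ => hw l
    simpa using h
  have hpos := sum_exp_pos (fun l => a * (bump d j s l + x l)) j
  refine ((hw k).div hZ hpos.ne').congr_deriv ?_
  simp only [choiceProb, softmax]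
  split_ifs <;> field_simp
  ring

lemma hasDerivAt_share_bump (a : ℝ) (d : Fin I → ℝ) (k j : Fin I) :
    HasDerivAt (fun s => share a (bump d j s) k)
      (a * ((if k = j then share a d k else 0) - pairShare a d k j)) 0 := by
  have hmeas : ∀ s, Continuous fun x => a * ((if k = j then choiceProb a (bump d j s) x k else 0) -
      choiceProb a (bump d j s) x k * choiceProb a (bump d j s) x j) := by
    intro s
    have h1 := continuous_choiceProb a (bump d j s) k
    have h2 := continuous_choiceProb a (bump d j s) j
    split_ifs <;> fun_prop
  have h := hasDerivAt_integral_of_dominated_loc_of_deriv_le (μ := _root_.stdGaussian I) (𝕜 := ℝ)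
    (F := fun s x => choiceProb a (bump d j s) x k)
    (F' := fun s x => a * ((if k = j then choiceProb a (bump d j s) x k else 0) -
      choiceProb a (bump d j s) x k * choiceProb a (bump d j s) x j))
    (x₀ := 0) (s := Set.univ) (bound := fun _ => |a|) Filter.univ_mem
    (Filter.Eventually.of_forall fun s => (continuous_choiceProb _ _ k).aestronglyMeasurable)
    (integrable_choiceProb _ _ k) (hmeas 0).aestronglyMeasurable
    (Filter.Eventually.of_forall fun x s _ => by
      rw [Real.norm_eq_abs, abs_mul]
      refine mul_le_of_le_one_right (abs_nonneg a) (abs_le.2 ?_)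
      have h1 := choiceProb_pos a (bump d j s) x k
      have h2 := choiceProb_pos a (bump d j s) x j
      have h3 := choiceProb_le_one a (bump d j s) x k
      have h4 := choiceProb_le_one a (bump d j s) x j
      split_ifs <;> constructor <;> nlinarith)
    (integrable_const _)
    (Filter.Eventually.of_forall fun x s _ => hasDerivAt_choiceProb_bump a d x k j s)
  refine h.2.congr_deriv ?_
  simp only [bump_zero]
  rw [integral_const_mul]
  congr 1
  split_ifs
  · rw [integral_sub (integrable_choiceProb a d k) (integrable_choiceProb_mul a d k j)]
    rfl
  · simp only [zero_sub, integral_neg]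
    rfl

/-- The insider's objective in terms of the differences `d i - d k`. -/
def insiderValue (a : ℝ) (i : Fin I) (d : Fin I → ℝ) : ℝ := ∑ k, share a d k * (d i - d k)

lemma continuous_insiderValue (a : ℝ) (i : Fin I) : Continuous (insiderValue a i) := by
  unfold insiderValue
  refine continuous_finsetSum _ fun k _ => Continuous.mul ?_ (by fun_prop)
  exact (continuous_share k).comp (continuous_const.prodMk continuous_id)

lemma insiderValue_sub_const (a : ℝ) (i : Fin I) (d : Fin I → ℝ) (c : ℝ) :
    insiderValue a i (fun k => d k - c) = insiderValue a i d := by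
  have h : ∀ k, share a (fun k => d k - c) k = share a d k := by
    intro k
    unfold share choiceProb
    refine integral_congr_ae (Filter.Eventually.of_forall fun x => ?_)
    simp only
    rw [← softmax_add_const (fun k => a * (d k + x k)) (-(a * c)) k]
    congr 1
    funext l
    ring
  simp only [insiderValue, h, sub_sub_sub_cancel_right]

lemma hasDerivAt_insiderValue_bump (a : ℝ) {i j : Fin I} (hij : j ≠ i) (d : Fin I → ℝ) :
    HasDerivAt (fun s => insiderValue a i (bump d j s))
      (-share a d j + a * ∑ k, pairShare a d k j * (d k - d j)) 0 := by
  have hb : ∀ k, HasDerivAt (fun s => bump d j s i - bump d j s k) (-(if k = j then 1 else 0)) 0 := by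
    intro k
    by_cases hk : k = j
    · simp only [bump, hij.symm, hk, if_true, if_false]
      simpa using ((hasDerivAt_id (0 : ℝ)).const_add (d j)).const_sub (d i + 0)
    · simp only [bump, hij.symm, hk, if_false, neg_zero]
      exact hasDerivAt_const _ _
  have h := HasDerivAt.fun_sum (u := Finset.univ) fun k _ =>
    (hasDerivAt_share_bump a d k j).fun_mul (hb k)
  refine h.congr_deriv ?_
  simp only [bump_zero]
  have e : ∀ k, a * ((if k = j then share a d k else 0) - pairShare a d k j) * (d i - d k) +
      share a d k * -(if k = j then 1 else 0) =
      (if k = j then a * share a d j * (d i - d j) - share a d j else 0) -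
        a * (pairShare a d k j * (d i - d j)) + a * (pairShare a d k j * (d k - d j)) := by
    intro k
    split_ifs with hk
    · subst hk; ring
    · ring
  simp only [e]
  rw [Finset.sum_add_distrib, Finset.sum_sub_distrib, ← Finset.mul_sum, ← Finset.mul_sum,
    ← Finset.sum_mul, sum_pairShare]
  simp only [Finset.sum_ite_eq', Finset.mem_univ, if_true]
  ring

lemma deriv_nonpos_of_right_max {f : ℝ → ℝ} {f' ε : ℝ} (hf : HasDerivAt f f' 0) (hε : 0 < ε)
    (h : ∀ s, 0 < s → s < ε → f s ≤ f 0) : f' ≤ 0 := by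
  have ht := hf.tendsto_slope_zero_right
  refine le_of_tendsto ht ?_
  filter_upwards [Ioo_mem_nhdsGT hε] with s hs
  simp only [zero_add, smul_eq_mul]
  exact mul_nonpos_of_nonneg_of_nonpos (inv_nonneg.2 hs.1.le) (sub_nonpos.2 (h s hs.1 hs.2))

lemma deriv_nonneg_of_left_max {f : ℝ → ℝ} {f' ε : ℝ} (hf : HasDerivAt f f' 0) (hε : 0 < ε)
    (h : ∀ s, 0 < s → s < ε → f (-s) ≤ f 0) : 0 ≤ f' := by
  have hf2 : HasDerivAt (fun s => f (-s)) (-f') 0 := by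
    have hf0 : HasDerivAt f f' (-(0 : ℝ)) := by simpa using hf
    have := hf0.comp (0 : ℝ) (hasDerivAt_neg (0 : ℝ))
    simpa [Function.comp_def] using this
  have := deriv_nonpos_of_right_max hf2 hε (by simpa using h)
  linarith

/-- The symmetric profile at a fixed point globally maximizes the insider's objective. -/
lemma insiderValue_le_symProfile (hI : 2 ≤ I) {a : ℝ} (ha : 0 < a) (i : Fin I)
    (hfix : ∀ j, j ≠ i → share a (symProfile i a) j = a ^ 2 * pairShare a (symProfile i a) i j)
    (d : Fin I → ℝ) (hdi : d i = 0) : insiderValue a i d ≤ insiderValue a i (symProfile i a) := by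
  set N : ℝ := a + 1 + ∑ k, |d k| with hN
  have hsum : ∀ k, |d k| ≤ ∑ k, |d k| := fun k =>
    Finset.single_le_sum (fun k _ => abs_nonneg (d k)) (Finset.mem_univ k)
  have hNa : a < N := by linarith [(abs_nonneg _).trans (hsum i)]
  have hmemiff : ∀ D : Fin I → ℝ, D ∈ Set.Icc (symProfile i N) (symProfile i (-N)) ↔
      D i = 0 ∧ ∀ k, k ≠ i → -N ≤ D k ∧ D k ≤ N := by
    intro D
    simp only [Set.mem_Icc, Pi.le_def, symProfile, neg_neg]
    constructor
    · rintro ⟨h1, h2⟩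
      refine ⟨le_antisymm (by simpa using h2 i) (by simpa using h1 i), fun k hk => ?_⟩
      simpa [hk] using And.intro (h1 k) (h2 k)
    · rintro ⟨h1, h2⟩
      constructor <;> intro k <;> by_cases hk : k = i
      · simp [hk, h1]
      · simpa [hk] using (h2 k hk).1
      · simp [hk, h1]
      · simpa [hk] using (h2 k hk).2
  have hdmem : d ∈ Set.Icc (symProfile i N) (symProfile i (-N)) := by
    rw [hmemiff]
    refine ⟨hdi, fun k _ => ?_⟩
    have := abs_le.1 (hsum k)
    constructor <;> linarith
  obtain ⟨D, hD, hmax⟩ := isCompact_Icc.exists_isMaxOn ⟨d, hdmem⟩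
    (continuous_insiderValue a i).continuousOn
  have hmax' : ∀ x ∈ Set.Icc (symProfile i N) (symProfile i (-N)),
      insiderValue a i x ≤ insiderValue a i D := fun x hx => hmax hx
  refine (hmax' d hdmem).trans (le_of_eq ?_)
  obtain ⟨hDi, hDb⟩ := (hmemiff D).1 hD
  have hne : (Finset.univ.erase i).Nonempty := by
    rw [← Finset.card_pos, Finset.card_erase_of_mem (Finset.mem_univ i), Finset.card_univ,
      Fintype.card_fin]
    omega
  obtain ⟨t, ht, htmax⟩ := Finset.exists_max_image _ D hne
  obtain ⟨b, hb, hbmin⟩ := Finset.exists_min_image _ D hne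
  replace ht := Finset.ne_of_mem_erase ht
  replace hb := Finset.ne_of_mem_erase hb
  replace htmax : ∀ k, k ≠ i → D k ≤ D t := fun k hk => htmax k (by simp [hk])
  replace hbmin : ∀ k, k ≠ i → D b ≤ D k := fun k hk => hbmin k (by simp [hk])
  have hbump : ∀ j s, j ≠ i → -N ≤ D j + s → D j + s ≤ N →
      insiderValue a i (bump D j s) ≤ insiderValue a i (bump D j 0) := by
    intro j s hj h1 h2
    rw [bump_zero]
    refine hmax' _ ((hmemiff _).2 ⟨by simp [bump, hj.symm, hDi], fun k hk => ?_⟩)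
    by_cases hkj : k = j
    · subst hkj; simp [bump, h1, h2]
    · simpa [bump, hkj] using hDb k hk
  have hsplit : ∀ j, ∑ k, pairShare a D k j * (D k - D j) = pairShare a D i j * -D j +
      ∑ k ∈ Finset.univ.erase i, pairShare a D k j * (D k - D j) := by
    intro j
    rw [← Finset.add_sum_erase _ _ (Finset.mem_univ i), hDi, zero_sub]
  have hT : -N < D t → share a D t ≤ a * (pairShare a D i t * -D t) := by
    intro h
    have h1 := deriv_nonneg_of_left_max (hasDerivAt_insiderValue_bump a ht D)
      (sub_pos.2 h) fun s hs hs' => hbump t (-s) ht (by linarith) (by linarith [(hDb t ht).2])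
    have h2 : ∑ k ∈ Finset.univ.erase i, pairShare a D k t * (D k - D t) ≤ 0 :=
      Finset.sum_nonpos fun k hk => mul_nonpos_of_nonneg_of_nonpos (pairShare_pos a D k t).le
        (sub_nonpos.2 (htmax k (Finset.ne_of_mem_erase hk)))
    rw [hsplit, mul_add] at h1
    linarith [mul_nonpos_of_nonneg_of_nonpos ha.le h2]
  have hB : D b < N → a * (pairShare a D i b * -D b) ≤ share a D b := by
    intro h
    have h1 := deriv_nonpos_of_right_max (hasDerivAt_insiderValue_bump a hb D)
      (sub_pos.2 h) fun s hs hs' => hbump b s hb (by linarith [(hDb b hb).1]) (by linarith)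
    have h2 : 0 ≤ ∑ k ∈ Finset.univ.erase i, pairShare a D k b * (D k - D b) :=
      Finset.sum_nonneg fun k hk => mul_nonneg (pairShare_pos a D k b).le
        (sub_nonneg.2 (hbmin k (Finset.ne_of_mem_erase hk)))
    rw [hsplit, mul_add] at h1
    linarith [mul_nonneg ha.le h2]
  have hpos := pairShare_pos a D i
  have hRpos := pairShare_pos a (symProfile i a) i
  have hDbN : D b < N := by
    by_contra hcon
    have h1 := hT (by linarith [hbmin t ht])
    have h2 : pairShare a D i t * -D t ≤ 0 :=
      mul_nonpos_of_nonneg_of_nonpos (hpos t).le (by linarith [hbmin t ht])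
    linarith [mul_nonpos_of_nonneg_of_nonpos ha.le h2, share_pos a D t]
  have hBb := hB hDbN
  have hlow : D t ≤ -a → -a ≤ D b := by
    intro h
    have h1 := pairShare_mul_share_le ha (d := symProfile i a) (d' := D) hb.symm hb.symm
      (by simp [symProfile, hDi])
      (fun k => by
        by_cases hk : k = i
        · simp [symProfile, hk, hDi]
        · simpa [symProfile, hk] using (htmax k hk).trans h)
      (by simpa [symProfile, hb] using (htmax b hb).trans h)
    rw [hfix b hb] at h1
    have h2 : share a D b ≤ a ^ 2 * pairShare a D i b :=
      le_of_mul_le_mul_left (by linarith) (hRpos b)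
    have h3 : (a * pairShare a D i b) * -D b ≤ (a * pairShare a D i b) * a := by linarith
    linarith [le_of_mul_le_mul_left h3 (mul_pos ha (hpos b))]
  have hDtN : -N < D t := by
    by_contra hcon
    linarith [hlow (by linarith), hbmin t ht]
  have hTt := hT hDtN
  have heq : D t ≤ D b := by
    have h1 := pairShare_mul_share_le ha (d := D) (d' := D) ht.symm hb.symm rfl (fun _ => le_rfl)
      (htmax b hb)
    have h2 := mul_le_mul_of_nonneg_left hBb (hpos t).le
    have h3 := mul_le_mul_of_nonneg_right hTt (hpos b).le
    have h4 : (a * pairShare a D i t * pairShare a D i b) * -D b ≤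
        (a * pairShare a D i t * pairShare a D i b) * -D t := by linarith
    linarith [le_of_mul_le_mul_left h4 (mul_pos (mul_pos ha (hpos t)) (hpos b))]
  have hhigh : -a ≤ D b → D t ≤ -a := by
    intro h
    have h1 := pairShare_mul_share_le ha (d := D) (d' := symProfile i a) ht.symm ht.symm
      (by simp [symProfile, hDi])
      (fun k => by
        by_cases hk : k = i
        · simp [symProfile, hk, hDi]
        · simpa [symProfile, hk] using h.trans (hbmin k hk))
      (by simpa [symProfile, ht] using h.trans (hbmin t ht))
    rw [hfix t ht] at h1
    have h2 : a ^ 2 * pairShare a D i t ≤ share a D t :=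
      le_of_mul_le_mul_right (by linarith) (hRpos t)
    have h3 : (a * pairShare a D i t) * a ≤ (a * pairShare a D i t) * -D t := by linarith
    linarith [le_of_mul_le_mul_left h3 (mul_pos ha (hpos t))]
  congr 1
  funext k
  by_cases hk : k = i
  · simp [symProfile, hk, hDi]
  · have h1 := htmax k hk
    have h2 := hbmin k hk
    simp only [symProfile, if_neg hk]
    rcases le_total (D t) (-a) with h | h
    · linarith [hlow h]
    · linarith [hhigh (h.trans heq)]

lemma smul_Qmat_apply (a : ℝ) (k j : Fin I) :
    (a • Qmat I) k j = a * ((if k = j then 1 else 0) - (I : ℝ)⁻¹) := by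
  simp [Qmat, Matrix.one_apply]

lemma postMap_smul_Qmat (a : ℝ) (ω : Fin I → ℝ) (j : Fin I) :
    postMap I (a • Qmat I) ω j = softmax (fun k => a * ω k) j := by
  have h1 : ∀ l, (∑ k, (a • Qmat I) k l * ω k) - (∑ k, ((a • Qmat I) k l) ^ 2) / 2 =
      a * ω l + (-(a * (I : ℝ)⁻¹ * ∑ k, ω k) -
        a ^ 2 * (1 - 2 * (I : ℝ)⁻¹ + I * (I : ℝ)⁻¹ ^ 2) / 2) := by
    intro l
    have e1 : ∀ k, (a • Qmat I) k l * ω k =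
        (if k = l then a * ω k else 0) - a * (I : ℝ)⁻¹ * ω k := by
      intro k; rw [smul_Qmat_apply]; split_ifs <;> ring
    have e2 : ∀ k, ((a • Qmat I) k l) ^ 2 =
        (if k = l then a ^ 2 * (1 - 2 * (I : ℝ)⁻¹) else 0) + a ^ 2 * (I : ℝ)⁻¹ ^ 2 := by
      intro k; rw [smul_Qmat_apply]; split_ifs <;> ring
    simp only [e1, e2, Finset.sum_sub_distrib, Finset.sum_add_distrib, Finset.sum_ite_eq',
      Finset.mem_univ, if_true, ← Finset.mul_sum, Finset.sum_const, Finset.card_univ,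
      Fintype.card_fin, nsmul_eq_mul]
    ring
  rw [← softmax_add_const _ (-(a * (I : ℝ)⁻¹ * ∑ k, ω k) -
    a ^ 2 * (1 - 2 * (I : ℝ)⁻¹ + I * (I : ℝ)⁻¹ ^ 2) / 2)]
  simp only [postMap, h1, softmax]

lemma Jobj_smul_Qmat (a : ℝ) (i : Fin I) (d : Fin I → ℝ) :
    Jobj I (a • Qmat I) i d = insiderValue a i d := by
  have h : ∀ j, postBar I (a • Qmat I) d j = share a d j := by
    intro j
    simp only [postBar, postMap_smul_Qmat, share, choiceProb, Pi.add_apply]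
  simp only [Jobj, insiderValue, h, mul_sub, Finset.sum_sub_distrib, ← Finset.sum_mul,
    sum_share a d i, one_mul]

end Equilibrium

/-- For every `I ≥ 2` there exists `α* > 0` such that `α*·Q` is an equilibrium of the
canonical game. -/
theorem exists_symmetric_equilibrium (I : ℕ) (hI : 2 ≤ I) :
    ∃ αStar : ℝ, 0 < αStar ∧ IsEquilibrium I (αStar • Qmat I) := by
  obtain ⟨a, ha, hfix⟩ := exists_fixed_point hI
  refine ⟨a, ha, fun i d => ?_⟩
  rw [Jobj_smul_Qmat, Jobj_smul_Qmat, ← insiderValue_sub_const a i d (d i),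
    ← insiderValue_sub_const a i (fun k => (a • Qmat I) k i) ((a • Qmat I) i i)]
  have hcol : (fun k => (a • Qmat I) k i - (a • Qmat I) i i) = symProfile i a := by
    funext k
    simp only [smul_Qmat_apply, symProfile, if_true]
    split_ifs <;> ring
  rw [hcol]
  exact insiderValue_le_symProfile hI ha i (hfix i) _ (sub_self _)

end
end

section
/- For α ≥ 0 define the insider's expected profit g(α) = ∫_ℝ 2α/(e^{αt} + 1) dν_α(t), where ν_α is the Gaussian measure on ℝ with mean 6α and variance 12. Then g(0) = 0 and lim_{α→∞} g(α) = 0. -/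
open MeasureTheory ProbabilityTheory Filter

noncomputable section

/-- The insider's expected profit in the toy model when trading the high-volatility
long-short portfolio scaled by `α`: `g(α) = ∫ 2α/(e^{αt} + 1) dν_α(t)`, where `ν_α` is the
Gaussian measure with mean `6α` and variance `12`. -/
def insiderProfit (α : ℝ) : ℝ :=
  ∫ t, 2 * α / (Real.exp (α * t) + 1) ∂(gaussianReal (6 * α) 12)

lemma inv_exp_add_one_le_exp_neg_half (x : ℝ) :
    (Real.exp x + 1)⁻¹ ≤ Real.exp (-(x / 2)) := by
  rw [Real.exp_neg]
  refine inv_anti₀ (Real.exp_pos _) ?_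
  have h : Real.exp x = Real.exp (x / 2) ^ 2 := by
    rw [← Real.exp_nat_mul]
    congr 1
    push_cast
    ring
  nlinarith [sq_nonneg (Real.exp (x / 2) - 1)]

lemma insiderProfit_nonneg {α : ℝ} (hα : 0 ≤ α) : 0 ≤ insiderProfit α :=
  integral_nonneg fun t => by positivity

lemma insiderProfit_le {α : ℝ} (hα : 0 ≤ α) :
    insiderProfit α ≤ 2 * α * Real.exp (-(3 / 2 * α ^ 2)) := by
  have hmgf : ∫ t, Real.exp (-(α / 2) * t) ∂(gaussianReal (6 * α) 12) =
      Real.exp (-(3 / 2 * α ^ 2)) := by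
    have h := congrFun (mgf_id_gaussianReal (μ := 6 * α) (v := 12)) (-(α / 2))
    simp only [mgf, id] at h
    rw [h]
    congr 1
    push_cast
    ring
  rw [← hmgf, ← integral_const_mul]
  refine integral_mono_of_nonneg (ae_of_all _ fun t => by positivity)
    ((integrable_exp_mul_gaussianReal _).const_mul _) (ae_of_all _ fun t => ?_)
  have h := inv_exp_add_one_le_exp_neg_half (α * t)
  rw [show -(α * t / 2) = -(α / 2) * t by ring] at h
  exact mul_le_mul_of_nonneg_left h (by positivity)

/-- `g(0) = 0` and `g(α) → 0` as `α → ∞`. -/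
theorem insider_profit_vanishes_at_extremes :
    insiderProfit 0 = 0 ∧ Tendsto insiderProfit atTop (nhds 0) := by
  refine ⟨by simp [insiderProfit], ?_⟩
  have hlim : Tendsto (fun α : ℝ => 2 * (α ^ 1 * Real.exp (-α))) atTop (nhds 0) := by
    simpa using (Real.tendsto_pow_mul_exp_neg_atTop_nhds_zero 1).const_mul 2
  refine tendsto_of_tendsto_of_tendsto_of_le_of_le' tendsto_const_nhds hlim ?_ ?_
  · filter_upwards [eventually_ge_atTop 0] with α hα using insiderProfit_nonneg hα
  · filter_upwards [eventually_ge_atTop 1] with α hα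
    have hα₀ : 0 ≤ α := zero_le_one.trans hα
    refine (insiderProfit_le hα₀).trans ?_
    rw [pow_one, ← mul_assoc]
    gcongr
    nlinarith

end
end
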